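/- The set { δ : 0 < δ < 1/2 and Ω(δ) < 1 } is nonempty; i.e., there exists δ ∈ (0, 1/2) with Ω(δ) < 1. -/

import Mathlib

open MeasureTheory Real

noncomputable section

/-- `Ω(δ) = (1/π) ∫₀¹ (1+(1-r)^{1/2})⁻¹ (1-r)^{-1/2} [ (1/(1-2δ))(r^{-1/2} - r^{-δ}) + r^{1/2-δ} ] dr`. -/
def OmegaFn (δ : ℝ) : ℝ :=
  (1 / Real.pi) *
    ∫ r in (0 : ℝ)..1,
      (1 + (1 - r) ^ ((1 : ℝ) / 2))⁻¹ * (1 - r) ^ (-(1 : ℝ) / 2) *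
        ((1 / (1 - 2 * δ)) * (r ^ (-(1 : ℝ) / 2) - r ^ (-δ)) + r ^ ((1 : ℝ) / 2 - δ))

/-- The set `{δ ∈ (0, 1/2) : Ω(δ) < 1}` is nonempty. -/
theorem exists_delta_Omega_lt_one :
    ∃ δ : ℝ, 0 < δ ∧ δ < 1 / 2 ∧ OmegaFn δ < 1 := by
  refine ⟨1 / 4, by norm_num, by norm_num, ?_⟩
  unfold OmegaFn
  set f : ℝ → ℝ := fun r => (1 + (1 - r) ^ ((1 : ℝ) / 2))⁻¹ * (1 - r) ^ (-(1 : ℝ) / 2) *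
        ((1 / (1 - 2 * (1 / 4 : ℝ))) * (r ^ (-(1 : ℝ) / 2) - r ^ (-(1 / 4 : ℝ)))
          + r ^ ((1 : ℝ) / 2 - 1 / 4)) with hf
  have hpi := Real.pi_gt_three
  suffices h : ∫ r in (0 : ℝ)..1, f r < 3 by
    rw [one_div, inv_mul_lt_iff₀ (by linarith)]
    linarith
  by_cases hi : IntervalIntegrable f volume 0 1
  swap
  · rw [intervalIntegral.integral_undef hi]; norm_num
  set F : ℝ → ℝ := fun r => 4 * √r / (1 + √(1 - r)) + 2 * Real.log (1 + √(1 - r)) with hF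
  have key : ∫ r in (0 : ℝ)..1, f r ≤ F 1 - F 0 := by
    refine intervalIntegral.integral_le_sub_of_hasDeriv_right_of_le
      (g' := fun r => (2 / √r - 1) / (√(1 - r) * (1 + √(1 - r)))) zero_le_one ?_ ?_ ?_ ?_
    · apply Continuous.continuousOn
      have h1 : ∀ r : ℝ, 1 + √(1 - r) ≠ 0 := fun r => by positivity
      rw [hF]
      exact (Continuous.div (by fun_prop) (by fun_prop) h1).add
        (continuous_const.mul (Continuous.log (by fun_prop) h1))
    · intro x hx
      apply HasDerivAt.hasDerivWithinAt
      have hx0 : 0 < x := hx.1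
      have hx1 : 0 < 1 - x := by linarith [hx.2]
      have hs := Real.sqrt_pos.2 hx0
      have hc := Real.sqrt_pos.2 hx1
      have hs2 := Real.sq_sqrt hx0.le
      have hc2 := Real.sq_sqrt hx1.le
      have d1 := (Real.hasDerivAt_sqrt hx0.ne')
      have d2 := ((hasDerivAt_id x).const_sub 1).sqrt hx1.ne'
      have d3 := d2.const_add 1
      have hne : 1 + √(1 - id x) ≠ 0 := by positivity
      have d4 := ((d1.const_mul 4).div d3 hne).add ((d3.log hne).const_mul 2)
      refine d4.congr_deriv ?_
      simp only [id]
      generalize √x = s at *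
      generalize √(1 - x) = c at *
      have e : s ^ 2 + c ^ 2 = 1 := by linarith
      have : (1 + c) ≠ 0 := by positivity
      field_simp
      linear_combination 4 * e
    · exact (intervalIntegrable_iff_integrableOn_Icc_of_le zero_le_one).1 hi
    · intro x hx
      have hx0 : 0 < x := hx.1
      have hx1 : 0 < 1 - x := by linarith [hx.2]
      have hs := Real.sqrt_pos.2 hx0
      have hc := Real.sqrt_pos.2 hx1
      have a1 : (1 - x) ^ (-(1 : ℝ) / 2) = (√(1 - x))⁻¹ := by
        rw [neg_div, Real.rpow_neg hx1.le, Real.sqrt_eq_rpow]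
      have a2 : x ^ (-(1 : ℝ) / 2) = (√x)⁻¹ := by
        rw [neg_div, Real.rpow_neg hx0.le, Real.sqrt_eq_rpow]
      have a3 : 1 ≤ x ^ (-(1 / 4 : ℝ)) :=
        Real.one_le_rpow_of_pos_of_le_one_of_nonpos hx0 hx.2.le (by norm_num)
      have a4 : x ^ ((1 : ℝ) / 2 - 1 / 4) ≤ 1 :=
        Real.rpow_le_one hx0.le hx.2.le (by norm_num)
      simp only [hf]
      rw [a1, a2, ← Real.sqrt_eq_rpow, div_eq_mul_inv (2 / √x - 1), mul_inv, mul_comm (2 / √x - 1),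
        mul_comm (√(1 - x))⁻¹]
      apply mul_le_mul_of_nonneg_left _ (by positivity)
      rw [div_eq_mul_inv 2]
      norm_num at a3 a4 ⊢
      linarith
  have : F 1 - F 0 = 4 - 2 * Real.log 2 := by
    simp only [hF]; norm_num
  have := Real.log_two_gt_d9
  linarith
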